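/- arXiv:1502.00360 — 9 statements merged into one kernel-verified Lean document; each statement's English description precedes it below -/
import Mathlib

section
/- For every finite group G, m(G) ≤ MaxDim(G); that is, if G has an irredundant generating sequence of length n, then G has a family of n maximal subgroups in general position. -/
/-- A sequence of group elements is irredundant if no element lies in the
subgroup generated by the others. -/
def Irredundant {G : Type*} [Group G] {n : ℕ} (g : Fin n → G) : Prop :=
  ∀ i, g i ∉ Subgroup.closure (g '' {j | j ≠ i})

/-- A sequence of group elements generates the group. -/
def Generates {G : Type*} [Group G] {n : ℕ} (g : Fin n → G) : Prop :=
  Subgroup.closure (Set.range g) = ⊤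

/-- A family of subgroups is in general position if removing any one member
strictly enlarges the intersection. -/
def InGeneralPosition {G : Type*} [Group G] {n : ℕ} (H : Fin n → Subgroup G) : Prop :=
  ∀ i, (⨅ j, H j) < ⨅ j ∈ {j | j ≠ i}, H j

/-- `mG G` is the maximum length of an irredundant generating sequence of `G`. -/
noncomputable def mG (G : Type*) [Group G] : ℕ :=
  sSup {n | ∃ g : Fin n → G, Irredundant g ∧ Generates g}

/-- `iG G` is the maximum length of an irredundant sequence in `G`. -/
noncomputable def iG (G : Type*) [Group G] : ℕ :=
  sSup {n | ∃ g : Fin n → G, Irredundant g}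

/-- `MaxDim G` is the maximum size of a family of maximal subgroups of `G`
in general position. -/
noncomputable def MaxDim (G : Type*) [Group G] : ℕ :=
  sSup {n | ∃ M : Fin n → Subgroup G, (∀ i, IsCoatom (M i)) ∧ InGeneralPosition M}

theorem Irredundant.exists_isCoatom_inGeneralPosition {G : Type*} [Group G] [Finite G] {n : ℕ}
    {g : Fin n → G} (hi : Irredundant g) (hg : Generates g) :
    ∃ M : Fin n → Subgroup G, (∀ i, IsCoatom (M i)) ∧ InGeneralPosition M := by
  have hex (i : Fin n) : ∃ M : Subgroup G, IsCoatom M ∧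
      Subgroup.closure (g '' {j | j ≠ i}) ≤ M := by
    refine (eq_top_or_exists_le_coatom _).resolve_left fun h => hi i ?_
    rw [h]
    exact Subgroup.mem_top _
  choose M hM hle using hex
  have hmem {i j : Fin n} (hij : j ≠ i) : g j ∈ M i :=
    hle i (Subgroup.subset_closure ⟨j, hij, rfl⟩)
  have hnot (i : Fin n) : g i ∉ M i := fun h => (hM i).1 <| by
    rw [eq_top_iff, ← hg, Subgroup.closure_le]
    rintro _ ⟨j, rfl⟩
    by_cases hj : j = i
    · exact hj ▸ h
    · exact hmem hj
  refine ⟨M, hM, fun i => lt_of_le_of_ne (le_iInf₂ fun j _ => iInf_le M j) fun heq => hnot i ?_⟩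
  have h : g i ∈ ⨅ j, M j := by
    rw [heq]
    simp only [Subgroup.mem_iInf]
    exact fun j hj => hmem (Ne.symm hj)
  exact Subgroup.mem_iInf.1 h i

theorem InGeneralPosition.le_natCard {G : Type*} [Group G] [Finite G] {n : ℕ}
    {H : Fin n → Subgroup G} (h : InGeneralPosition H) : n ≤ Nat.card G := by
  have hex (i : Fin n) : ∃ x : G, (∀ j, j ≠ i → x ∈ H j) ∧ x ∉ H i := by
    obtain ⟨x, hx, hnx⟩ := SetLike.exists_of_lt (h i)
    simp only [Subgroup.mem_iInf] at hx hnx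
    exact ⟨x, hx, fun hxi => hnx fun j => if hj : j = i then hj ▸ hxi else hx j hj⟩
  choose x hx hnx using hex
  have hinj : Function.Injective x := fun i j hij => by
    by_contra hne
    exact hnx i (hij ▸ hx j i hne)
  simpa using Nat.card_le_card_of_injective x hinj

/-- `m(G) ≤ MaxDim(G)`: every irredundant generating sequence of length `n` of a
finite group `G` yields a family of `n` maximal subgroups of `G` in general
position. -/
theorem mG_le_MaxDim (G : Type*) [Group G] [Finite G] :
    mG G ≤ MaxDim G ∧
      ∀ (n : ℕ) (g : Fin n → G), Irredundant g → Generates g →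
        ∃ M : Fin n → Subgroup G, (∀ i, IsCoatom (M i)) ∧ InGeneralPosition M := by
  refine ⟨csSup_le_csSup' ⟨Nat.card G, ?_⟩ ?_, fun n g hi hg =>
    hi.exists_isCoatom_inGeneralPosition hg⟩
  · rintro n ⟨M, -, hM⟩
    exact hM.le_natCard
  · rintro n ⟨g, hi, hg⟩
    exact hi.exists_isCoatom_inGeneralPosition hg
end

section
/- For every finite group G, MaxDim(G) ≤ i(G); more precisely, given any family of n subgroups of G in general position (not necessarily maximal), there exists an irredundant sequence (g₁, …, gₙ) in G of the same length n. -/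
theorem Irredundant.injective {G : Type*} [Group G] {n : ℕ} {g : Fin n → G}
    (hg : Irredundant g) : Function.Injective g := by
  intro i j hij
  by_contra hne
  exact hg i (Subgroup.subset_closure ⟨j, Ne.symm hne, hij.symm⟩)

theorem bddAbove_length_irredundant (G : Type*) [Group G] [Finite G] :
    BddAbove {n | ∃ g : Fin n → G, Irredundant g} := by
  refine ⟨Nat.card G, ?_⟩
  rintro n ⟨g, hg⟩
  simpa using Nat.card_le_card_of_injective g hg.injective

theorem InGeneralPosition.exists_irredundant {G : Type*} [Group G] {n : ℕ}
    {H : Fin n → Subgroup G} (hH : InGeneralPosition H) :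
    ∃ g : Fin n → G, Irredundant g := by
  have key : ∀ i, ∃ x, (∀ j, j ≠ i → x ∈ H j) ∧ x ∉ H i := by
    intro i
    obtain ⟨x, hx, hx'⟩ := SetLike.exists_of_lt (hH i)
    simp only [Subgroup.mem_iInf, Set.mem_ofPred_eq] at hx hx'
    refine ⟨x, hx, fun hi => hx' fun j => ?_⟩
    by_cases h : j = i
    · exact h ▸ hi
    · exact hx j h
  choose g hg hg' using key
  refine ⟨g, fun i hi => hg' i ((Subgroup.closure_le (H i)).2 ?_ hi)⟩
  rintro _ ⟨j, hj, rfl⟩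
  exact hg j i (Ne.symm hj)

/-- `MaxDim(G) ≤ i(G)`: from any family of `n` subgroups of a finite group `G`
in general position (not necessarily maximal) one obtains an irredundant
sequence of length `n`. -/
theorem MaxDim_le_iG (G : Type*) [Group G] [Finite G] :
    MaxDim G ≤ iG G ∧
      ∀ (n : ℕ) (H : Fin n → Subgroup G), InGeneralPosition H →
        ∃ g : Fin n → G, Irredundant g := by
  refine ⟨csSup_le_csSup (bddAbove_length_irredundant G) ?_ ?_,
    fun n H hH => hH.exists_irredundant⟩
  · exact ⟨0, fun i => i.elim0, fun i => i.elim0, fun i => i.elim0⟩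
  · rintro n ⟨M, -, hM⟩
    exact hM.exists_irredundant
end

section
/- If G is a finite group and N is a normal subgroup of G contained in the Frattini subgroup Φ(G), then m(G/N) = m(G). -/
/-- A generating sequence is irredundant exactly when no proper subsequence obtained by omitting
one term still generates. -/
theorem irredundant_and_generates_iff {G : Type*} [Group G] {n : ℕ} (g : Fin n → G) :
    Irredundant g ∧ Generates g ↔
      (∀ i, Subgroup.closure (g '' {j | j ≠ i}) ≠ ⊤) ∧ Generates g := by
  refine and_congr_left fun hgen => forall_congr' fun i => not_congr ⟨fun hi => ?_, fun hi => ?_⟩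
  · rw [eq_top_iff, ← hgen, Subgroup.closure_le]
    rintro _ ⟨j, rfl⟩
    by_cases hj : j = i
    · exact hj ▸ hi
    · exact Subgroup.subset_closure ⟨j, hj, rfl⟩
  · rw [hi]
    exact Subgroup.mem_top _

/-- A subset of a finite group generates it as soon as its image generates the quotient by a
normal subgroup contained in the Frattini subgroup. -/
theorem closure_image_mk'_eq_top_iff {G : Type*} [Group G] [Finite G]
    (N : Subgroup G) [N.Normal] (hN : N ≤ frattini G) (S : Set G) :
    Subgroup.closure (QuotientGroup.mk' N '' S) = ⊤ ↔ Subgroup.closure S = ⊤ := by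
  rw [← MonoidHom.map_closure]
  constructor
  · intro h
    apply frattini_nongenerating
    have hsup : Subgroup.closure S ⊔ N = ⊤ := by
      have hcomap := Subgroup.comap_map_eq (QuotientGroup.mk' N) (Subgroup.closure S)
      rwa [h, Subgroup.comap_top, QuotientGroup.ker_mk', eq_comm] at hcomap
    exact top_le_iff.mp (hsup ▸ sup_le_sup_left hN _)
  · intro h
    rw [h, Subgroup.map_top_of_surjective _ (QuotientGroup.mk'_surjective N)]

/-- If `N` is a normal subgroup of a finite group `G` contained in the Frattini
subgroup `Φ(G)`, then `m(G/N) = m(G)`. -/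
theorem mG_quotient_frattini {G : Type*} [Group G] [Finite G]
    (N : Subgroup G) [N.Normal] (hN : N ≤ frattini G) :
    mG (G ⧸ N) = mG G := by
  unfold mG
  congr 1
  ext n
  simp only [Set.mem_ofPred_eq, irredundant_and_generates_iff]
  constructor
  · rintro ⟨g, hg, hgen⟩
    obtain ⟨f, rfl⟩ := (QuotientGroup.mk'_surjective N).comp_left g
    refine ⟨f, fun i hi => hg i ?_, ?_⟩
    · rw [Set.image_comp, closure_image_mk'_eq_top_iff N hN, hi]
    · rwa [Generates, Set.range_comp, closure_image_mk'_eq_top_iff N hN] at hgen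
  · rintro ⟨f, hf, hgen⟩
    refine ⟨QuotientGroup.mk' N ∘ f, fun i hi => hf i ?_, ?_⟩
    · rwa [Set.image_comp, closure_image_mk'_eq_top_iff N hN] at hi
    · rwa [Generates, Set.range_comp, closure_image_mk'_eq_top_iff N hN]
end

section
/- Let G be a finite abelian group, written as a direct sum of cyclic groups of prime power order: G ≅ ⊕_{i=1}^k ℤ/p_i^{e_i}ℤ with each p_i prime and e_i ≥ 1. Then m(G) = i(G) = k; in particular, every finite abelian group is flat. -/
section Irredundant

variable {G : Type*}

theorem Irredundant.of_map {H : Type*} [Group G] [Group H] (f : G →* H) {n : ℕ} {g : Fin n → G}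
    (h : Irredundant (f ∘ g)) : Irredundant g := fun i hi => by
  refine h i ?_
  rw [Set.image_comp, ← MonoidHom.map_closure]
  exact Subgroup.mem_map_of_mem f hi

theorem MulEquiv.irredundant_comp [Group G] {H : Type*} [Group H] (f : G ≃* H) {n : ℕ}
    {g : Fin n → G} (h : Irredundant g) : Irredundant (f ∘ g) := by
  refine Irredundant.of_map f.symm.toMonoidHom ?_
  convert h
  ext i
  simp

theorem MulEquiv.generates_comp [Group G] {H : Type*} [Group H] (f : G ≃* H) {n : ℕ}
    {g : Fin n → G} (h : Generates g) : Generates (f ∘ g) := by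
  have := MonoidHom.map_closure f.toMonoidHom (Set.range g)
  unfold Generates at *
  rw [Set.range_comp]
  rw [h, Subgroup.map_top_of_surjective _ f.surjective] at this
  exact this.symm

variable [CommGroup G]

/-- The subgroup generated by all members of a sequence but the `i`-th one. -/
abbrev closureExcept {n : ℕ} (g : Fin n → G) (i : Fin n) : Subgroup G :=
  Subgroup.closure (g '' {j | j ≠ i})

theorem mk_closureExcept_of_ne {n : ℕ} (g : Fin n → G) {i j : Fin n} (h : j ≠ i) :
    QuotientGroup.mk' (closureExcept g i) (g j) = 1 :=
  (QuotientGroup.eq_one_iff _).2 (Subgroup.subset_closure ⟨j, h, rfl⟩)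

theorem Generates.mem_zpowers {n : ℕ} {g : Fin n → G} (hg : Generates g) (i : Fin n) (x : G) :
    QuotientGroup.mk' (closureExcept g i) x ∈
      Subgroup.zpowers (QuotientGroup.mk' (closureExcept g i) (g i)) := by
  have h : Subgroup.closure (Set.range g) ≤
      (Subgroup.zpowers (QuotientGroup.mk' (closureExcept g i) (g i))).comap
        (QuotientGroup.mk' (closureExcept g i)) := by
    rw [Subgroup.closure_le]
    rintro _ ⟨j, rfl⟩
    by_cases hj : j = i
    · subst hj
      exact Subgroup.mem_zpowers _
    · rw [SetLike.mem_coe, Subgroup.mem_comap, mk_closureExcept_of_ne g hj]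
      exact one_mem _
  rw [hg] at h
  exact h (Subgroup.mem_top x)

theorem Irredundant.orderOf_ne_one {n : ℕ} {g : Fin n → G} (hg : Irredundant g) (i : Fin n) :
    orderOf (QuotientGroup.mk' (closureExcept g i) (g i)) ≠ 1 := by
  rw [Ne, orderOf_eq_one_iff]
  exact fun h => hg i ((QuotientGroup.eq_one_iff _).1 h)

theorem Generates.pow_card_le_card_ker [Finite G] {n : ℕ} {g : Fin n → G} (hg : Generates g)
    (q : ℕ) (S : Finset (Fin n))
    (hS : ∀ i ∈ S, q ∣ orderOf (QuotientGroup.mk' (closureExcept g i) (g i))) :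
    q ^ S.card ≤ Nat.card (powMonoidHom q : G →* G).ker := by
  rw [← Subgroup.index_range, Subgroup.index]
  have hcard : Nat.card (S → Fin q) = q ^ S.card := by simp
  rw [← hcard]
  refine Nat.card_le_card_of_injective
    (fun a => QuotientGroup.mk (∏ j, g j.1 ^ (a j : ℕ))) fun a b hab => ?_
  obtain ⟨y, hy⟩ := QuotientGroup.eq.1 hab
  rw [eq_inv_mul_iff_mul_eq] at hy
  ext ⟨i, hi⟩
  have key (c : S → Fin q) : QuotientGroup.mk' (closureExcept g i) (∏ j, g j.1 ^ (c j : ℕ)) =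
      QuotientGroup.mk' (closureExcept g i) (g i) ^ (c ⟨i, hi⟩ : ℕ) := by
    rw [map_prod, Fintype.prod_eq_single ⟨i, hi⟩, map_pow]
    intro j hj
    rw [map_pow, mk_closureExcept_of_ne g fun h => hj (Subtype.ext h), one_pow]
  obtain ⟨m, hm⟩ := hg.mem_zpowers i y
  have h := congrArg (QuotientGroup.mk' (closureExcept g i)) hy
  dsimp only at hm
  rw [map_mul, key, key, powMonoidHom_apply, map_pow, ← hm, ← zpow_natCast, ← zpow_natCast,
    ← zpow_natCast, ← zpow_mul, ← zpow_add, zpow_eq_zpow_iff_modEq] at h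
  replace h := h.of_dvd (Int.natCast_dvd_natCast.2 (hS i hi))
  have h' : ((a ⟨i, hi⟩ : ℕ) : ℤ) ≡ (b ⟨i, hi⟩ : ℕ) [ZMOD q] :=
    (by simp [Int.ModEq] : _ ≡ _ [ZMOD q]).trans h
  exact (Int.natCast_modEq_iff.1 h').eq_of_lt_of_lt (a _).isLt (b _).isLt

end Irredundant

section PrimePowers

variable {k : ℕ} {p e : Fin k → ℕ}

theorem card_ker_powMonoidHom_pi (hp : ∀ i, (p i).Prime) (he : ∀ i, 1 ≤ e i)
    {q : ℕ} (hq : q.Prime) :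
    Nat.card (powMonoidHom q : ((i : Fin k) → Multiplicative (ZMod (p i ^ e i))) →* _).ker =
      q ^ (Finset.univ.filter (p · = q)).card := by
  have (i : Fin k) : NeZero (p i ^ e i) := ⟨pow_ne_zero _ (hp i).ne_zero⟩
  have hpi : Nat.card (powMonoidHom q : ((i : Fin k) → Multiplicative (ZMod (p i ^ e i))) →* _).ker
      = Nat.card ((i : Fin k) → (powMonoidHom q : Multiplicative (ZMod (p i ^ e i)) →* _).ker) := by
    refine Nat.card_congr ((Equiv.subtypeEquivRight fun x => ?_).trans
      (Equiv.subtypePiEquivPi (p := fun i x =>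
        x ∈ (powMonoidHom q : Multiplicative (ZMod (p i ^ e i)) →* _).ker)))
    simp [MonoidHom.mem_ker, funext_iff]
  rw [hpi, Nat.card_pi, Finset.card_filter, ← Finset.prod_pow_eq_pow_sum]
  refine Finset.prod_congr rfl fun i _ => ?_
  rw [IsCyclic.card_powMonoidHom_ker, Nat.card_congr Multiplicative.toAdd, Nat.card_zmod]
  split_ifs with h
  · subst h
    rw [pow_one]
    exact Nat.gcd_eq_right (dvd_pow_self _ (by have := he i; omega))
  · rw [pow_zero]
    exact Nat.Coprime.pow_left _ ((Nat.coprime_primes (hp i) hq).2 h)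

theorem Irredundant.le_of_mulEquiv {G : Type*} [CommGroup G] [Finite G]
    (hp : ∀ i, (p i).Prime) (he : ∀ i, 1 ≤ e i)
    (iso : G ≃* ((i : Fin k) → Multiplicative (ZMod (p i ^ e i)))) {n : ℕ} {g : Fin n → G}
    (hg : Irredundant g) : n ≤ k := by
  let H := Subgroup.closure (Set.range g)
  let h : Fin n → H := fun i => ⟨g i, Subgroup.subset_closure ⟨i, rfl⟩⟩
  have hh : Irredundant h := Irredundant.of_map H.subtype hg
  have hgen : Generates h := by
    refine Subgroup.map_injective H.subtype_injective ?_
    rw [MonoidHom.map_closure, ← Set.range_comp, ← MonoidHom.range_eq_map, H.range_subtype]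
    rfl
  let r : Fin n → ℕ := fun i =>
    (orderOf (QuotientGroup.mk' (closureExcept h i) (h i))).minFac
  have hr (i : Fin n) : (r i).Prime := Nat.minFac_prime (hh.orderOf_ne_one i)
  have hle {q : ℕ} (hq : q.Prime) :
      (Finset.univ.filter (r · = q)).card ≤ (Finset.univ.filter (p · = q)).card := by
    rw [← Nat.pow_le_pow_iff_right hq.one_lt, ← card_ker_powMonoidHom_pi hp he hq]
    refine (hgen.pow_card_le_card_ker q _ fun i hi => ?_).trans ?_
    · rw [← (Finset.mem_filter.1 hi).2]
      exact Nat.minFac_dvd _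
    · have : Finite ((i : Fin k) → Multiplicative (ZMod (p i ^ e i))) := .of_equiv _ iso.toEquiv
      refine Nat.card_le_card_of_injective
        (fun x => ⟨iso (x : H), ?_⟩) fun x y hxy => ?_
      · rw [MonoidHom.mem_ker, powMonoidHom_apply, ← map_pow, ← Subgroup.coe_pow,
          ← powMonoidHom_apply, x.2, Subgroup.coe_one, map_one]
      · exact Subtype.ext (Subtype.ext (iso.injective (congrArg Subtype.val hxy)))
  let t := Finset.univ.image r ∪ Finset.univ.image p
  calc
    n = ∑ q ∈ t, (Finset.univ.filter (r · = q)).card := by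
      rw [← Finset.card_eq_sum_card_fiberwise fun i _ => by simp [t], Finset.card_fin]
    _ ≤ ∑ q ∈ t, (Finset.univ.filter (p · = q)).card := by
      refine Finset.sum_le_sum fun q hq => hle ?_
      obtain h | h := Finset.mem_union.1 hq <;> obtain ⟨i, -, rfl⟩ := Finset.mem_image.1 h
      exacts [hr i, hp i]
    _ = k := by
      rw [← Finset.card_eq_sum_card_fiberwise fun i _ => by simp [t], Finset.card_fin]

end PrimePowers

section StandardGenerators

variable {k : ℕ} (m : Fin k → ℕ)

/-- The standard generators of a direct product of finite cyclic groups. -/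
def stdGenerators (i : Fin k) : (i : Fin k) → Multiplicative (ZMod (m i)) :=
  Pi.mulSingle i (Multiplicative.ofAdd 1)

theorem irredundant_stdGenerators (hm : ∀ i, m i ≠ 1) : Irredundant (stdGenerators m) := by
  intro i hi
  have hle : Subgroup.closure (stdGenerators m '' {j | j ≠ i}) ≤
      (Pi.evalMonoidHom (fun i => Multiplicative (ZMod (m i))) i).ker := by
    rw [Subgroup.closure_le]
    rintro _ ⟨j, hj, rfl⟩
    exact Pi.mulSingle_eq_of_ne (Ne.symm hj) _
  have h : Pi.mulSingle (M := fun i => Multiplicative (ZMod (m i))) i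
      (Multiplicative.ofAdd 1) i = 1 := hle hi
  rw [Pi.mulSingle_eq_same, ofAdd_eq_one] at h
  have := (ZMod.natCast_eq_zero_iff 1 (m i)).1 (by exact_mod_cast h)
  exact hm i (Nat.dvd_one.1 this)

theorem generates_stdGenerators : Generates (stdGenerators m) := by
  refine eq_top_iff.2 fun x _ => ?_
  rw [← Finset.univ_prod_mulSingle x]
  refine Subgroup.prod_mem _ fun i _ => ?_
  obtain ⟨c, hc⟩ := ZMod.intCast_surjective (x i).toAdd
  have : Pi.mulSingle i (x i) = stdGenerators m i ^ c := by
    rw [stdGenerators, ← Pi.mulSingle_zpow, ← ofAdd_zsmul, zsmul_one, hc, ofAdd_toAdd]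
  rw [this]
  exact Subgroup.zpow_mem _ (Subgroup.subset_closure (Set.mem_range_self i)) c

end StandardGenerators

/-- A finite abelian group `G ≅ ⊕_{i=1}^k ℤ/p_i^{e_i}ℤ` (each `p_i` prime,
`e_i ≥ 1`) satisfies `m(G) = i(G) = k`; in particular `G` is flat. -/
theorem mG_eq_iG_of_finite_abelian {G : Type*} [CommGroup G] [Finite G]
    (k : ℕ) (p e : Fin k → ℕ) (hp : ∀ i, (p i).Prime) (he : ∀ i, 1 ≤ e i)
    (iso : G ≃* ((i : Fin k) → Multiplicative (ZMod (p i ^ e i)))) :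
    mG G = k ∧ iG G = k := by
  have hm (i : Fin k) : p i ^ e i ≠ 1 :=
    (Nat.one_lt_pow (Nat.one_le_iff_ne_zero.1 (he i)) (hp i).one_lt).ne'
  have hirr := iso.symm.irredundant_comp (irredundant_stdGenerators _ hm)
  have hgen := iso.symm.generates_comp (generates_stdGenerators fun i => p i ^ e i)
  rw [mG, iG]
  refine ⟨IsGreatest.csSup_eq ⟨⟨_, hirr, hgen⟩, ?_⟩, IsGreatest.csSup_eq ⟨⟨_, hirr⟩, ?_⟩⟩
  · rintro n ⟨g, hg, -⟩
    exact hg.le_of_mulEquiv hp he iso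
  · rintro n ⟨g, hg⟩
    exact hg.le_of_mulEquiv hp he iso
end

section
/- Let n ≥ 5, let p be a prime, and let G = A_n ≀ ℤ/pℤ = (A_n)^p ⋊ ℤ/pℤ, where ℤ/pℤ acts by cyclically permuting the p factors. Then MaxDim(G) ≥ p(n−3); that is, G has a family of p(n−3) maximal subgroups in general position. -/
/-- The action of `ℤ/pℤ` on `(ZMod p → A)` by cyclically shifting coordinates. -/
def cycShift (p : ℕ) (A : Type*) [Group A] :
    Multiplicative (ZMod p) →* MulAut (ZMod p → A) where
  toFun k :=
    { toFun := fun f i => f (i + k.toAdd)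
      invFun := fun f i => f (i - k.toAdd)
      left_inv := fun f => funext fun i => by simp
      right_inv := fun f => funext fun i => by simp
      map_mul' := fun f g => rfl }
  map_one' := by
    ext f i
    simp
  map_mul' := fun a b => by
    ext f i
    simp [add_assoc]

/-- The wreath product `A ≀ ℤ/pℤ = (A)^p ⋊ ℤ/pℤ`, with `ℤ/pℤ` acting by cyclic
permutation of the coordinates. -/
abbrev Wreath (p : ℕ) (A : Type*) [Group A] :=
  SemidirectProduct (ZMod p → A) (Multiplicative (ZMod p)) (cycShift p A)

open MulAction

lemma cycShift_apply (p : ℕ) (A : Type*) [Group A] (k : Multiplicative (ZMod p))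
    (f : ZMod p → A) (i : ZMod p) : cycShift p A k f i = f (i + k.toAdd) := rfl

namespace Wreath

variable {p : ℕ} {A X : Type*} [Group A] [MulAction A X]

/-- The stabilizer of a point of `ZMod p → X` under the product action of the wreath product. -/
def productStabilizer (x : ZMod p → X) : Subgroup (Wreath p A) where
  carrier := {g | ∀ i, g.left i • x (i + g.right.toAdd) = x i}
  one_mem' i := by simp
  mul_mem' {g h} hg hh i := by
    have h1 := hh (i + g.right.toAdd)
    have h2 := hg i
    simp only [SemidirectProduct.mul_left, SemidirectProduct.mul_right, Pi.mul_apply,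
      cycShift_apply, toAdd_mul, mul_smul, ← add_assoc]
    rw [h1, h2]
  inv_mem' {g} hg i := by
    have h1 := hg (i - g.right.toAdd)
    rw [sub_add_cancel] at h1
    simp only [SemidirectProduct.inv_left, SemidirectProduct.inv_right, cycShift_apply, toAdd_inv,
      Pi.inv_apply, ← sub_eq_add_neg]
    rw [← h1, inv_smul_smul]

lemma mem_productStabilizer {x : ZMod p → X} {g : Wreath p A} :
    g ∈ productStabilizer x ↔ ∀ i, g.left i • x (i + g.right.toAdd) = x i := Iff.rfl

lemma inl_mem_productStabilizer {x : ZMod p → X} {f : ZMod p → A} :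
    (SemidirectProduct.inl f : Wreath p A) ∈ productStabilizer x ↔ ∀ i, f i • x i = x i := by
  simp [mem_productStabilizer]

lemma inl_mulSingle_mem_productStabilizer {x : ZMod p → X} {i : ZMod p} {a : A} :
    (SemidirectProduct.inl (Pi.mulSingle i a) : Wreath p A) ∈ productStabilizer x ↔
      a • x i = x i := by
  rw [inl_mem_productStabilizer]
  refine ⟨fun h => by simpa using h i, fun h j => ?_⟩
  rcases eq_or_ne j i with rfl | hj
  · simpa using h
  · simp [hj]

lemma exists_mem_productStabilizer_right_eq [IsPretransitive A X] (x : ZMod p → X)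
    (c : Multiplicative (ZMod p)) : ∃ h ∈ productStabilizer (A := A) x, h.right = c := by
  choose f hf using fun i => exists_smul_eq A (x (i + c.toAdd)) (x i)
  exact ⟨⟨f, c⟩, hf, rfl⟩

/-- In a wreath product with a doubly transitive base group on at least three points, the point
stabilizers of the product action are maximal. -/
theorem isCoatom_productStabilizer [NeZero p] [IsMultiplyPretransitive A X 2]
    (hX : 3 ≤ ENat.card X) (x : ZMod p → X) : IsCoatom (productStabilizer (A := A) x) := by
  have hA : IsPreprimitive A X := isPreprimitive_of_is_two_pretransitive ‹_›
  have third : ∀ a b : X, ∃ c, c ≠ a ∧ c ≠ b := by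
    intro a b
    by_contra! h
    have : (Set.univ : Set X) ⊆ {a, b} := fun c _ => by
      by_cases hc : c = a
      · exact Or.inl hc
      · exact Or.inr (h c hc)
    have h3 := (Set.encard_le_encard this).trans (Set.encard_insert_le {b} a)
    rw [Set.encard_univ, Set.encard_singleton, one_add_one_eq_two] at h3
    exact absurd (hX.trans h3) (by norm_num)
  have : Nontrivial X := ⟨x 0, (third (x 0) (x 0)).choose, (third (x 0) (x 0)).choose_spec.1.symm⟩
  have move : ∀ a b : X, b ≠ a → ∃ d : A, d • a = a ∧ d • b ≠ b := by
    intro a b hab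
    obtain ⟨c, hca, hcb⟩ := third a b
    obtain ⟨d, h, h'⟩ := is_two_pretransitive_iff.mp
      ‹IsMultiplyPretransitive A X 2› hab.symm hca.symm
    exact ⟨d, h, h' ▸ hcb⟩
  constructor
  · intro htop
    obtain ⟨c, hc, -⟩ := third (x 0) (x 0)
    obtain ⟨a, ha⟩ := exists_smul_eq A (x 0) c
    have : (SemidirectProduct.inl (Pi.mulSingle 0 a) : Wreath p A) ∈ productStabilizer x :=
      htop ▸ Subgroup.mem_top _
    rw [inl_mulSingle_mem_productStabilizer, ha] at this
    exact hc this
  · intro K hK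
    obtain ⟨hle, k, hkK, hk⟩ := SetLike.lt_iff_le_and_exists.mp hK
    obtain ⟨i, g, hg, hgi⟩ : ∃ i, ∃ g : ZMod p → A, (SemidirectProduct.inl g : Wreath p A) ∈ K ∧
        g i • x i ≠ x i := by
      obtain ⟨h, hh, hr⟩ := exists_mem_productStabilizer_right_eq (A := A) x k.right
      have key : (SemidirectProduct.inl (k * h⁻¹).left : Wreath p A) = k * h⁻¹ := by
        ext <;> simp [hr]
      have hkh : k * h⁻¹ ∉ productStabilizer x := fun H => hk (by simpa using mul_mem H hh)
      rw [← key, inl_mem_productStabilizer, not_forall] at hkh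
      obtain ⟨i, hi⟩ := hkh
      exact ⟨i, _, key ▸ mul_mem hkK (inv_mem (hle hh)), hi⟩
    -- The elements of `A` which, placed in coordinate `i`, lie in `K`.
    let L : Subgroup A :=
      K.comap ((SemidirectProduct.inl : _ →* Wreath p A).comp (MonoidHom.mulSingle (fun _ => A) i))
    have hL : L = ⊤ := by
      apply (IsPreprimitive.isCoatom_stabilizer_of_isPreprimitive (G := A) (x i)).2
      refine SetLike.lt_iff_le_and_exists.mpr ⟨fun a ha => hle ?_, ?_⟩
      · exact inl_mulSingle_mem_productStabilizer.mpr ha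
      · obtain ⟨d, hd, hd'⟩ := move (x i) ((g i)⁻¹ • x i) (fun H => hgi (by
          rw [inv_smul_eq_iff] at H; exact H.symm))
        refine ⟨g i * d * (g i)⁻¹, ?_, fun H => hd' ?_⟩
        · have hdK : (SemidirectProduct.inl (Pi.mulSingle i d) : Wreath p A) ∈ K :=
            hle (inl_mulSingle_mem_productStabilizer.mpr hd)
          have e : (Pi.mulSingle i (g i * d * (g i)⁻¹) : ZMod p → A) =
              g * Pi.mulSingle i d * g⁻¹ := by
            ext j
            rcases eq_or_ne j i with rfl | hj
            · simp
            · simp [hj]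
          change SemidirectProduct.inl (Pi.mulSingle i (g i * d * (g i)⁻¹)) ∈ K
          rw [e, map_mul, map_mul, map_inv]
          exact mul_mem (mul_mem hg hdK) (inv_mem hg)
        · rw [mem_stabilizer_iff, mul_smul, mul_smul] at H
          exact eq_inv_smul_iff.mpr H
    have hsingle : ∀ a, (SemidirectProduct.inl (Pi.mulSingle i a) : Wreath p A) ∈ K := fun a =>
      (hL ▸ Subgroup.mem_top a : a ∈ L)
    have hbase : ∀ f, (SemidirectProduct.inl f : Wreath p A) ∈ K := by
      intro f
      refine Subgroup.pi_mem_of_mulSingle_mem (H := K.comap SemidirectProduct.inl) f fun j => ?_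
      obtain ⟨h, hh, hr⟩ := exists_mem_productStabilizer_right_eq (A := A) x
        (Multiplicative.ofAdd (i - j))
      have e : (SemidirectProduct.inl (Pi.mulSingle j (f j)) : Wreath p A) * h =
          h * SemidirectProduct.inl (Pi.mulSingle i ((h.left j)⁻¹ * f j * h.left j)) := by
        ext l
        · simp only [SemidirectProduct.mul_left, SemidirectProduct.left_inl,
            SemidirectProduct.right_inl, map_one, MulAut.one_apply, Pi.mul_apply, cycShift_apply,
            hr, toAdd_ofAdd]
          rcases eq_or_ne l j with rfl | hl
          · simp [mul_assoc]
          · have : l + (i - j) ≠ i := fun H => hl (by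
              have := congrArg (· - (i - j)) H
              simpa using this)
            simp [hl, this]
        · simp
      rw [Subgroup.mem_comap, eq_mul_inv_of_mul_eq e]
      exact mul_mem (mul_mem (hle hh) (hsingle _)) (inv_mem (hle hh))
    rw [eq_top_iff]
    intro k' _
    obtain ⟨h, hh, hr⟩ := exists_mem_productStabilizer_right_eq (A := A) x k'.right
    have key : (SemidirectProduct.inl (k' * h⁻¹).left : Wreath p A) * h = k' := by
      rw [show (SemidirectProduct.inl (k' * h⁻¹).left : Wreath p A) = k' * h⁻¹ by
        ext <;> simp [hr], inv_mul_cancel_right]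
    exact key ▸ mul_mem (hbase _) (hle hh)

end Wreath

section GeneralPosition

variable {G : Type*} [Group G] {m : ℕ} {M : Fin m → Subgroup G}

lemma inGeneralPosition_of_exists
    (h : ∀ i, ∃ g, g ∉ M i ∧ ∀ j, j ≠ i → g ∈ M j) : InGeneralPosition M := by
  intro i
  obtain ⟨g, hg, hg'⟩ := h i
  refine SetLike.lt_iff_le_and_exists.mpr ⟨le_iInf₂ fun j _ => iInf_le M j, g, ?_, fun H => ?_⟩
  · simpa [Subgroup.mem_iInf] using hg'
  · exact hg (Subgroup.mem_iInf.mp H i)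

lemma InGeneralPosition.injective (h : InGeneralPosition M) : Function.Injective M := by
  intro i j hij
  by_contra hne
  have hle : ∀ k, k ≠ i → ⨅ l ∈ {l | l ≠ i}, M l ≤ M k := fun k hk =>
    iInf₂_le (f := fun l (_ : l ∈ {l | l ≠ i}) => M l) k hk
  refine (h i).not_ge (le_iInf fun k => ?_)
  by_cases hk : k = i
  · rw [hk, hij]
    exact hle j (Ne.symm hne)
  · exact hle k hk

lemma InGeneralPosition.le_maxDim [Finite G] (hM : ∀ i, IsCoatom (M i))
    (h : InGeneralPosition M) : m ≤ MaxDim G := by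
  refine le_csSup ⟨Nat.card (Subgroup G), ?_⟩ ⟨M, hM, h⟩
  rintro k ⟨N, -, hN⟩
  simpa using Nat.card_le_card_of_injective N hN.injective

end GeneralPosition

/-- For `n ≥ 5`, `p` prime, and `G = A_n ≀ ℤ/pℤ`, we have `MaxDim G ≥ p(n-3)`:
`G` has a family of `p(n-3)` maximal subgroups in general position. -/
theorem MaxDim_wreath_alternating_ge {n p : ℕ} (hn : 5 ≤ n) (hp : p.Prime) :
    p * (n - 3) ≤ MaxDim (Wreath p (alternatingGroup (Fin n))) ∧
      ∃ M : Fin (p * (n - 3)) → Subgroup (Wreath p (alternatingGroup (Fin n))),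
        (∀ i, IsCoatom (M i)) ∧ InGeneralPosition M := by
  have : NeZero p := ⟨hp.ne_zero⟩
  have : Finite (Wreath p (alternatingGroup (Fin n))) :=
    .of_equiv _ SemidirectProduct.equivProd.symm
  have hmt := alternatingGroup.isMultiplyPretransitive (Fin n)
  have : IsMultiplyPretransitive (alternatingGroup (Fin n)) (Fin n) 2 :=
    isMultiplyPretransitive_of_le (n := Nat.card (Fin n) - 2) (by simp; omega) (by simp)
  have hcard : (3 : ℕ∞) ≤ ENat.card (Fin n) := by
    rw [ENat.card_eq_coe_fintype_card, Fintype.card_fin]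
    exact_mod_cast (by omega : 3 ≤ n)
  let e : Fin (p * (n - 3)) ≃ ZMod p × Fin (n - 3) :=
    finProdFinEquiv.symm.trans ((ZMod.finEquiv p).toEquiv.prodCongr (Equiv.refl _))
  let pt (k : Fin (n - 3)) : Fin n := ⟨k + 1, by omega⟩
  let x (q : ZMod p × Fin (n - 3)) : ZMod p → Fin n :=
    Function.update (fun _ => ⟨0, by omega⟩) q.1 (pt q.2)
  suffices H : ∃ M : Fin (p * (n - 3)) → Subgroup (Wreath p (alternatingGroup (Fin n))),
      (∀ i, IsCoatom (M i)) ∧ InGeneralPosition M from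
    ⟨let ⟨_, hM, hM'⟩ := H; hM'.le_maxDim hM, H⟩
  refine ⟨fun i => Wreath.productStabilizer (x (e i)),
    fun i => Wreath.isCoatom_productStabilizer hcard _, inGeneralPosition_of_exists fun i => ?_⟩
  let u : Fin n := ⟨n - 2, by omega⟩
  let v : Fin n := ⟨n - 1, by omega⟩
  have hu : ∀ k, pt k ≠ u := fun k => by simp only [pt, u, ne_eq, Fin.mk.injEq]; omega
  have hv : ∀ k, pt k ≠ v := fun k => by simp only [pt, v, ne_eq, Fin.mk.injEq]; omega
  have huv : u ≠ v := by simp only [u, v, ne_eq, Fin.mk.injEq]; omega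
  let k := pt (e i).2
  let c : alternatingGroup (Fin n) := ⟨Equiv.swap k u * Equiv.swap u v, by
    simp [Equiv.Perm.mem_alternatingGroup, Equiv.Perm.sign_swap (hu _), Equiv.Perm.sign_swap huv,
      k]⟩
  have hfix : ∀ y, y ≠ k → y ≠ u → y ≠ v → c • y = y := fun y h1 h2 h3 => by
    change Equiv.swap k u (Equiv.swap u v y) = y
    rw [Equiv.swap_apply_of_ne_of_ne h2 h3, Equiv.swap_apply_of_ne_of_ne h1 h2]
  have hmove : c • k ≠ k := by
    change Equiv.swap k u (Equiv.swap u v k) ≠ k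
    rw [Equiv.swap_apply_of_ne_of_ne (hu _) (hv _), Equiv.swap_apply_left]
    exact (hu _).symm
  refine ⟨SemidirectProduct.inl (Pi.mulSingle (e i).1 c), ?_, fun j hj => ?_⟩
  · rw [Wreath.inl_mulSingle_mem_productStabilizer]
    simpa [x] using hmove
  · rw [Wreath.inl_mulSingle_mem_productStabilizer]
    have hne : e j ≠ e i := e.injective.ne hj
    by_cases h : (e j).1 = (e i).1
    · have h2 : (e j).2 ≠ (e i).2 := fun h2 => hne (Prod.ext h h2)
      have : pt (e j).2 ≠ k := fun H => h2 (by
        simp only [pt, k, Fin.mk.injEq] at H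
        exact Fin.ext (by omega))
      simpa [x, ← h] using hfix _ this (hu _) (hv _)
    · have hx : x (e j) (e i).1 = ⟨0, by omega⟩ :=
        Function.update_of_ne (Ne.symm h) _ _
      rw [hx]
      apply hfix <;> simp only [k, pt, u, v, ne_eq, Fin.mk.injEq] <;> omega
end

section
/- (Whiston's replacement lemma) Let (g₁, …, g_m) be an irredundant generating sequence of a group G and let N be a normal subgroup of G. Then, after reordering the g_i, there exist k ≤ m and elements h_{k+1}, …, h_m ∈ N such that the images of g₁, …, g_k in G/N form an irredundant generating sequence of G/N, and (g₁, …, g_k, h_{k+1}, …, h_m) is an irredundant generating sequence of G. -/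
/-- A subset of `Fin m` can be moved to an initial segment by a permutation. -/
theorem exists_perm_mem_iff_lt {m : ℕ} (S : Finset (Fin m)) :
    ∃ σ : Equiv.Perm (Fin m), ∀ i, σ i ∈ S ↔ (i : ℕ) < S.card := by
  have hcard : Fintype.card {i : Fin m // (i : ℕ) < S.card} = Fintype.card {i // i ∈ S} := by
    have hS : S.card ≤ m := by simpa using S.card_le_univ
    rw [Fintype.card_coe, Fintype.card_subtype, Fin.card_filter_val_lt, min_eq_right hS]
  let e : {i : Fin m // (i : ℕ) < S.card} ≃ {i // i ∈ S} := Fintype.equivOfCardEq hcard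
  refine ⟨e.extendSubtype, fun i => ⟨fun hi => ?_, fun hi => e.extendSubtype_mem i hi⟩⟩
  by_contra hlt
  exact e.extendSubtype_not_mem i hlt hi

theorem Irredundant.comp_perm {G : Type*} [Group G] {m : ℕ} {g : Fin m → G}
    (hg : Irredundant g) (σ : Equiv.Perm (Fin m)) : Irredundant (g ∘ σ) := by
  intro i hi
  refine hg (σ i) (Subgroup.closure_mono ?_ hi)
  rintro _ ⟨j, hj, rfl⟩
  exact ⟨σ j, fun h => hj (σ.injective h), rfl⟩

theorem Generates.comp_perm {G : Type*} [Group G] {m : ℕ} {g : Fin m → G}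
    (hg : Generates g) (σ : Equiv.Perm (Fin m)) : Generates (g ∘ σ) := by
  rwa [Generates, σ.surjective.range_comp]

/-- A generating family indexed by a finite type contains a subfamily that generates and
is minimal with this property. -/
theorem exists_finset_irredundant_closure_eq_top {Q ι : Type*} [Group Q] [Fintype ι]
    [DecidableEq ι] (q : ι → Q) (hq : Subgroup.closure (Set.range q) = ⊤) :
    ∃ S : Finset ι, Subgroup.closure (q '' S) = ⊤ ∧
      ∀ i ∈ S, q i ∉ Subgroup.closure (q '' (S \ {i} : Set ι)) := by
  obtain ⟨S, hS⟩ := exists_minimal_of_wellFoundedLT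
    (fun S : Finset ι => Subgroup.closure (q '' S) = ⊤) ⟨Finset.univ, by simpa using hq⟩
  refine ⟨S, hS.prop, fun i hi hmem => ?_⟩
  have herase : Subgroup.closure (q '' (S.erase i : Finset ι)) = ⊤ := by
    rw [Finset.coe_erase, eq_top_iff, ← hS.prop, Subgroup.closure_le]
    rintro _ ⟨j, hj, rfl⟩
    by_cases hji : j = i
    · exact hji ▸ hmem
    · exact Subgroup.subset_closure ⟨j, ⟨hj, hji⟩, rfl⟩
  exact Finset.notMem_erase i S (hS.le_of_le herase (Finset.erase_subset i S) hi)

/-- If the images of the `g i` with `i ∈ S` irredundantly generate `G ⧸ N`, then the remaining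
members of an irredundant family `g` can be replaced by elements of `N`. -/
theorem exists_replacement {G ι : Type*} [Group G] (N : Subgroup G) [N.Normal] (g : ι → G)
    (hirr : ∀ i, g i ∉ Subgroup.closure (g '' {j | j ≠ i})) (S : Set ι)
    (hgen : Subgroup.closure ((fun i => (g i : G ⧸ N)) '' S) = ⊤)
    (hS : ∀ i ∈ S, (g i : G ⧸ N) ∉
      Subgroup.closure ((fun i => (g i : G ⧸ N)) '' (S \ {i}))) :
    ∃ h : ι → G, (∀ i ∈ S, h i = g i) ∧ (∀ i ∉ S, h i ∈ N) ∧
      (∀ i, h i ∉ Subgroup.closure (h '' {j | j ≠ i})) ∧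
      Subgroup.closure (Set.range h) = Subgroup.closure (Set.range g) := by
  classical
  have hw : ∀ i, ∃ w ∈ Subgroup.closure (g '' S), w⁻¹ * g i ∈ N := by
    intro i
    have hi : (g i : G ⧸ N) ∈ (Subgroup.closure (g '' S)).map (QuotientGroup.mk' N) := by
      rw [MonoidHom.map_closure, Set.image_image]
      exact hgen.ge trivial
    obtain ⟨w, hwS, hwi⟩ := hi
    exact ⟨w, hwS, QuotientGroup.eq.mp hwi⟩
  choose w hwS hwN using hw
  let h : ι → G := fun i => if i ∈ S then g i else (w i)⁻¹ * g i
  have h_mem : ∀ i ∈ S, h i = g i := fun i hi => if_pos hi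
  have h_notMem : ∀ i ∉ S, h i = (w i)⁻¹ * g i := fun i hi => if_neg hi
  have h_closure : ∀ T : Set ι, S ⊆ T →
      Subgroup.closure (h '' T) = Subgroup.closure (g '' T) := by
    intro T hT
    have himage : h '' S = g '' S := Set.image_congr h_mem
    apply le_antisymm <;> rw [Subgroup.closure_le] <;> rintro _ ⟨j, hj, rfl⟩
    · have hgj := Subgroup.subset_closure (Set.mem_image_of_mem g hj)
      by_cases hjS : j ∈ S
      · rwa [h_mem j hjS]
      · rw [h_notMem j hjS]
        exact mul_mem (inv_mem (Subgroup.closure_mono (Set.image_mono hT) (hwS j))) hgj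
    · have hhj := Subgroup.subset_closure (Set.mem_image_of_mem h hj)
      by_cases hjS : j ∈ S
      · rwa [h_mem j hjS] at hhj
      · have hwj : w j ∈ Subgroup.closure (h '' T) :=
          Subgroup.closure_mono (Set.image_mono hT) (himage ▸ hwS j)
        rw [h_notMem j hjS] at hhj
        exact (Subgroup.mul_mem_cancel_left _ (inv_mem hwj)).mp hhj
  refine ⟨h, h_mem, fun i hi => h_notMem i hi ▸ hwN i, fun i hi => ?_, ?_⟩
  · by_cases hiS : i ∈ S
    · have hmap := Subgroup.mem_map_of_mem (QuotientGroup.mk' N) hi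
      rw [MonoidHom.map_closure, Set.image_image, h_mem i hiS] at hmap
      refine hS i hiS (Subgroup.closure_le _ |>.mpr ?_ hmap)
      rintro _ ⟨j, hj, rfl⟩
      by_cases hjS : j ∈ S
      · exact Subgroup.subset_closure ⟨j, ⟨hjS, hj⟩, by simp [h_mem j hjS]⟩
      · have hone : QuotientGroup.mk' N (h j) = 1 :=
          (QuotientGroup.eq_one_iff _).mpr (h_notMem j hjS ▸ hwN j)
        exact (congrArg (· ∈ Subgroup.closure _) hone).mpr (one_mem _)
    · have hsub : S ⊆ {j | j ≠ i} := fun j hj hji => hiS (hji ▸ hj)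
      rw [h_closure _ hsub, h_notMem i hiS] at hi
      exact hirr i ((Subgroup.mul_mem_cancel_left _
        (inv_mem (Subgroup.closure_mono (Set.image_mono hsub) (hwS i)))).mp hi)
  · simpa using h_closure Set.univ (Set.subset_univ S)

/-- Whiston's replacement lemma: if `(g 1, …, g m)` is an irredundant generating
sequence of `G` and `N ⊴ G`, then after reordering by a permutation `σ` there
are `k ≤ m` and a sequence `h` agreeing with the reordered `g` in its first `k`
entries and lying in `N` thereafter, such that the images of the first `k`
entries form an irredundant generating sequence of `G/N` and `h` is an
irredundant generating sequence of `G`. -/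
theorem whiston_replacement {G : Type*} [Group G] (N : Subgroup G) [N.Normal]
    {m : ℕ} (g : Fin m → G) (hirr : Irredundant g) (hgen : Generates g) :
    ∃ (σ : Equiv.Perm (Fin m)) (k : ℕ) (hk : k ≤ m) (h : Fin m → G),
      (∀ i : Fin m, (i : ℕ) < k → h i = g (σ i)) ∧
      (∀ i : Fin m, k ≤ (i : ℕ) → h i ∈ N) ∧
      Irredundant (fun i : Fin k =>
        ((g (σ (Fin.castLE hk i)) : G) : G ⧸ N)) ∧
      Generates (fun i : Fin k =>
        ((g (σ (Fin.castLE hk i)) : G) : G ⧸ N)) ∧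
      Irredundant h ∧ Generates h := by
  have hquot : Subgroup.closure (Set.range fun i => (g i : G ⧸ N)) = ⊤ := by
    have hmap := congrArg (Subgroup.map (QuotientGroup.mk' N)) hgen
    rwa [MonoidHom.map_closure, ← Set.range_comp, Subgroup.map_top_of_surjective _
      (QuotientGroup.mk'_surjective N)] at hmap
  obtain ⟨S, hSgen, hSirr⟩ := exists_finset_irredundant_closure_eq_top _ hquot
  obtain ⟨σ, hσ⟩ := exists_perm_mem_iff_lt S
  have hk : S.card ≤ m := by simpa using S.card_le_univ
  have himage : (fun i => (g (σ i) : G ⧸ N)) '' {i | (i : ℕ) < S.card} =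
      (fun i => (g i : G ⧸ N)) '' S := by
    ext x
    constructor
    · rintro ⟨i, hi, rfl⟩
      exact ⟨σ i, (hσ i).mpr hi, rfl⟩
    · rintro ⟨j, hj, rfl⟩
      exact ⟨σ.symm j, (hσ _).mp (by simpa using hj), by simp⟩
  have hirrσ : ∀ i ∈ {i : Fin m | (i : ℕ) < S.card}, (g (σ i) : G ⧸ N) ∉
      Subgroup.closure ((fun i => (g (σ i) : G ⧸ N)) '' ({i | (i : ℕ) < S.card} \ {i})) := by
    intro i hi hmem
    refine hSirr (σ i) ((hσ i).mpr hi) (Subgroup.closure_mono ?_ hmem)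
    rintro _ ⟨j, ⟨hj, hji⟩, rfl⟩
    exact ⟨σ j, ⟨(hσ j).mpr hj, fun h => hji (σ.injective h)⟩, rfl⟩
  obtain ⟨h, hS, hN, hhirr, hhgen⟩ := exists_replacement N (g ∘ σ) (hirr.comp_perm σ)
    {i | (i : ℕ) < S.card} (himage ▸ hSgen) hirrσ
  refine ⟨σ, S.card, hk, h, hS, fun i hi => hN i hi.not_gt, fun i hi => ?_, ?_, hhirr,
    hhgen.trans (hgen.comp_perm σ)⟩
  · refine hirrσ (Fin.castLE hk i) i.isLt (Subgroup.closure_mono ?_ hi)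
    rintro _ ⟨j, hj, rfl⟩
    exact ⟨Fin.castLE hk j, ⟨j.isLt, fun h => hj (Fin.castLE_injective hk h)⟩, rfl⟩
  · rw [Generates, eq_top_iff, ← hSgen, ← himage]
    refine Subgroup.closure_mono ?_
    rintro _ ⟨i, hi, rfl⟩
    exact ⟨⟨i, hi⟩, rfl⟩
end

section
/- Let S be a nonabelian finite simple group, let M < S be a maximal subgroup, and let p be a prime. Then the naturally embedded subgroup M ≀ ℤ/pℤ = M^p ⋊ ℤ/pℤ is a maximal subgroup of the wreath product S ≀ ℤ/pℤ = S^p ⋊ ℤ/pℤ. -/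
/-- The natural copy of `M ≀ ℤ/pℤ = M^p ⋊ ℤ/pℤ` inside `S ≀ ℤ/pℤ`, for a
subgroup `M ≤ S`: elements whose `S^p`-component lies coordinatewise in `M`. -/
def wreathEmbed {p : ℕ} {S : Type*} [Group S] (M : Subgroup S) :
    Subgroup (Wreath p S) where
  carrier := {w | ∀ i, w.left i ∈ M}
  one_mem' := fun i => by
    simp only [SemidirectProduct.one_left, Pi.one_apply]
    exact M.one_mem
  mul_mem' := by
    intro a b ha hb i
    rw [SemidirectProduct.mul_left]
    exact M.mul_mem (ha i) (hb _)
  inv_mem' := by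
    intro a ha i
    rw [SemidirectProduct.inv_left]
    exact M.inv_mem (ha _)

/-- A maximal subgroup of a noncommutative group is nontrivial. -/
theorem IsCoatom.subgroup_ne_bot {S : Type*} [Group S] (hna : ∃ a b : S, a * b ≠ b * a)
    {M : Subgroup S} (hM : IsCoatom M) : M ≠ ⊥ := by
  rintro rfl
  obtain ⟨a, b, hab⟩ := hna
  have ha : a ≠ 1 := by
    rintro rfl
    simp at hab
  have htop : Subgroup.zpowers a = ⊤ :=
    hM.2 _ (bot_lt_iff_ne_bot.2 (Subgroup.zpowers_ne_bot.2 ha))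
  obtain ⟨n, rfl⟩ := Subgroup.mem_zpowers_iff.1 (htop ▸ Subgroup.mem_top b)
  exact hab (Commute.self_zpow a n).eq

/-- If `M` is a nontrivial maximal subgroup of a simple group `S`, a subgroup of a power of `S`
that contains the corresponding power of `M`, and an element whose `i`-th coordinate is not
in `M`, contains the whole `i`-th factor. -/
theorem Subgroup.mulSingle_mem_of_isCoatom {ι S : Type*} [DecidableEq ι] [Group S]
    [IsSimpleGroup S] {M : Subgroup S} (hM : IsCoatom M) (hbot : M ≠ ⊥)
    {K : Subgroup (ι → S)} (hK : Subgroup.pi Set.univ (fun _ => M) ≤ K)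
    {f : ι → S} (hf : f ∈ K) {i : ι} (hi : f i ∉ M) (x : S) : Pi.mulSingle i x ∈ K := by
  have hsingle : ∀ m ∈ M, Pi.mulSingle i m ∈ K := fun m hm =>
    hK ((Subgroup.mulSingle_mem_pi (H := fun _ => M) i m).2 fun _ => hm)
  have hproj : K.map (Pi.evalMonoidHom (fun _ => S) i) = ⊤ := by
    refine hM.2 _ (SetLike.lt_iff_le_and_exists.2 ⟨fun m hm => ?_, f i,
      Subgroup.mem_map_of_mem (Pi.evalMonoidHom (fun _ => S) i) hf, hi⟩)
    exact ⟨Pi.mulSingle i m, hsingle m hm, by simp⟩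
  have hnormal : (K.comap (MonoidHom.mulSingle (fun _ => S) i)).Normal := by
    refine ⟨fun n hn s => ?_⟩
    obtain ⟨g, hg, rfl⟩ : s ∈ K.map (Pi.evalMonoidHom (fun _ => S) i) :=
      hproj ▸ Subgroup.mem_top s
    have hconj : (Pi.mulSingle i (g i * n * (g i)⁻¹) : ι → S) =
        g * Pi.mulSingle i n * g⁻¹ := by
      ext j
      obtain rfl | hj := eq_or_ne j i
      · simp
      · simp [Pi.mulSingle_eq_of_ne hj]
    change (Pi.mulSingle i (g i * n * (g i)⁻¹) : ι → S) ∈ K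
    rw [hconj]
    exact K.mul_mem (K.mul_mem hg hn) (K.inv_mem hg)
  have htop : K.comap (MonoidHom.mulSingle (fun _ => S) i) = ⊤ := by
    refine hnormal.eq_bot_or_eq_top.resolve_left fun h => hbot ?_
    exact le_bot_iff.1 (h ▸ fun m hm => hsingle m hm)
  have hx : x ∈ K.comap (MonoidHom.mulSingle (fun _ => S) i) := htop ▸ Subgroup.mem_top x
  exact hx

theorem cycShift_mulSingle {p : ℕ} {A : Type*} [Group A] (k i : ZMod p) (x : A) :
    cycShift p A (Multiplicative.ofAdd k) (Pi.mulSingle i x) = Pi.mulSingle (i - k) x := by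
  ext j
  change (Pi.mulSingle i x : ZMod p → A) (j + k) = _
  simp only [Pi.mulSingle_apply, eq_sub_iff_add_eq]

/-- If `S` is a nonabelian finite simple group, `M < S` a maximal subgroup and
`p` a prime, then `M ≀ ℤ/pℤ` is a maximal subgroup of `S ≀ ℤ/pℤ`. -/
theorem wreathEmbed_isCoatom {p : ℕ} (hp : p.Prime)
    {S : Type*} [Group S] [Finite S] [IsSimpleGroup S]
    (hna : ∃ a b : S, a * b ≠ b * a)
    (M : Subgroup S) (hM : IsCoatom M) :
    IsCoatom (wreathEmbed (p := p) M) := by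
  obtain ⟨y, -, hy⟩ := SetLike.exists_of_lt hM.lt_top
  refine ⟨fun h => hy ?_, fun H hH => ?_⟩
  · have hmem : SemidirectProduct.inl (fun _ => y) ∈ wreathEmbed (p := p) M :=
      h ▸ Subgroup.mem_top _
    exact hmem 0
  obtain ⟨hle, w, hw, hwM⟩ := SetLike.lt_iff_le_and_exists.1 hH
  obtain ⟨i, hi⟩ : ∃ i, w.left i ∉ M := not_forall.1 hwM
  have hinr : ∀ k, SemidirectProduct.inr k ∈ H := fun k => hle fun _ => M.one_mem
  have hleft : w.left ∈ H.comap SemidirectProduct.inl := by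
    have hmem := H.mul_mem hw (H.inv_mem (hinr w.right))
    rwa [mul_inv_eq_of_eq_mul (SemidirectProduct.inl_left_mul_inr_right w).symm] at hmem
  have hK : Subgroup.pi Set.univ (fun _ => M) ≤ H.comap SemidirectProduct.inl :=
    fun f hf => hle fun j => hf j (Set.mem_univ j)
  have hfactor := Subgroup.mulSingle_mem_of_isCoatom hM (hM.subgroup_ne_bot hna) hK hleft hi
  have : NeZero p := ⟨hp.ne_zero⟩
  refine (Subgroup.eq_top_iff' H).2 fun v => ?_
  rw [← SemidirectProduct.inl_left_mul_inr_right v]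
  refine H.mul_mem ?_ (hinr _)
  refine Subgroup.pi_mem_of_mulSingle_mem (H := H.comap SemidirectProduct.inl) v.left
    fun j => ?_
  have hshift := cycShift_mulSingle (i - j) i (v.left j)
  rw [sub_sub_cancel] at hshift
  rw [← hshift, Subgroup.mem_comap, SemidirectProduct.inl_aut]
  exact H.mul_mem (H.mul_mem (hinr _) (hfactor _)) (hinr _)
end

section
/- Let G = P ⋊ K be a finite supersolvable group, where P is a normal Sylow p-subgroup of G for the largest prime p dividing |G|, K is a complement to P, and P ≅ (ℤ/pℤ)^r is elementary abelian. Then the conjugation representation π: K → Aut(P) decomposes into linear characters: P is the direct sum of r subgroups Q₁, …, Q_r, each of order p and each invariant under the conjugation action of K. -/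
/-- For subgroups `A B ≤ G` with `A` normal in `G`, the quotient `B / (A ∩ B)`
(that is, `B/A` when `A ≤ B`) is cyclic. -/
def CyclicQuot {G : Type*} [Group G] (A B : Subgroup G) (hA : A.Normal) : Prop := by
  letI : (A.subgroupOf B).Normal := hA.subgroupOf B
  exact IsCyclic (B ⧸ A.subgroupOf B)

/-- For subgroups `A ≤ B ≤ G` with `A` normal in `G`, the quotient `B/A`
is cyclic of prime order. -/
def PrimeCyclicQuot {G : Type*} [Group G] (A B : Subgroup G) (hA : A.Normal) : Prop := by
  letI : (A.subgroupOf B).Normal := hA.subgroupOf B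
  exact IsCyclic (B ⧸ A.subgroupOf B) ∧ (Nat.card (B ⧸ A.subgroupOf B)).Prime

/-- A group `G` is supersolvable if it has a chain
`1 = G₀ ≤ G₁ ≤ ⋯ ≤ Gₙ = G` of subgroups, each normal in `G`, with each
successive quotient `G_{i+1}/G_i` cyclic. -/
def Supersolvable (G : Type*) [Group G] : Prop :=
  ∃ (n : ℕ) (H : Fin (n + 1) → Subgroup G) (hnorm : ∀ i, (H i).Normal),
    H 0 = ⊥ ∧ H (Fin.last n) = ⊤ ∧
    (∀ i : Fin n, H i.castSucc ≤ H i.succ) ∧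
    ∀ i : Fin n, CyclicQuot (H i.castSucc) (H i.succ) (hnorm i.castSucc)

/-- Over a field, if `ρ` is semisimple and `V` has a filtration by invariant subspaces with at most
one-dimensional factors, then `V` is spanned by vectors that are eigenvectors of every `ρ g`. -/
theorem Representation.span_eigenvectors_eq_top {F K V : Type*} [Field F] [Group K]
    [AddCommGroup V] [Module F V] (ρ : Representation F K V)
    [ComplementedLattice (Subrepresentation ρ)] {n : ℕ} (A : Fin (n + 1) → Subrepresentation ρ)
    (hbot : A 0 = ⊥) (htop : A (Fin.last n) = ⊤) (hmono : ∀ i : Fin n, A i.castSucc ≤ A i.succ)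
    (hrank : ∀ i : Fin n, ∀ W : Submodule F V, W ≤ (A i.succ).toSubmodule →
      Disjoint W (A i.castSucc).toSubmodule → W.IsPrincipal) :
    Submodule.span F {v : V | ∀ g, ∃ c : F, ρ g v = c • v} = ⊤ := by
  set S := Submodule.span F {v : V | ∀ g, ∃ c : F, ρ g v = c • v}
  suffices h : ∀ i, (A i).toSubmodule ≤ S by
    have := h (Fin.last n)
    rw [htop] at this
    exact top_le_iff.mp this
  intro i
  induction i using Fin.induction with
  | zero => rw [hbot]; exact bot_le
  | succ i ih =>
    obtain ⟨C, hC⟩ := exists_isCompl (A i.castSucc)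
    have hdisj : Disjoint (C ⊓ A i.succ).toSubmodule (A i.castSucc).toSubmodule := by
      rw [disjoint_iff_inf_le]
      exact (hC.symm.disjoint.mono_left inf_le_left).le_bot
    obtain ⟨q, hq⟩ := (hrank i (C ⊓ A i.succ).toSubmodule inf_le_right hdisj).principal
    have hqS : q ∈ S := Submodule.subset_span fun g ↦ by
      have hqmem : q ∈ (C ⊓ A i.succ).toSubmodule := hq ▸ Submodule.mem_span_singleton_self q
      have := (C ⊓ A i.succ).apply_mem_toSubmodule g hqmem
      rw [hq] at this
      obtain ⟨c, hc⟩ := Submodule.mem_span_singleton.mp this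
      exact ⟨c, hc.symm⟩
    intro x hx
    have hxtop : x ∈ (A i.castSucc ⊔ C).toSubmodule := by
      rw [hC.sup_eq_top]; exact Submodule.mem_top (R := F)
    obtain ⟨a, ha, c, hc, rfl⟩ := Submodule.mem_sup.mp hxtop
    refine S.add_mem (ih ha) ?_
    have hcA : c ∈ (A i.succ).toSubmodule := by
      simpa using (A i.succ).toSubmodule.sub_mem hx (hmono i ha)
    have hcq : c ∈ (C ⊓ A i.succ).toSubmodule := ⟨hc, hcA⟩
    rw [hq] at hcq
    exact (Submodule.span_singleton_le_iff_mem _ _).mpr hqS hcq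

/-- The conjugation action on a normal subgroup, carried over to a `ZMod p`-module isomorphic to
that subgroup. -/
theorem Representation.exists_conj_apply {G V : Type*} [Group G] (p : ℕ) [AddCommGroup V]
    [Module (ZMod p) V] {P : Subgroup G} [P.Normal] (K : Subgroup G) (e : P ≃* Multiplicative V) :
    ∃ ρ : Representation (ZMod p) K V, ∀ (k : K) (v : V),
      (e.symm (.ofAdd (ρ k v)) : G) = k * e.symm (.ofAdd v) * (k : G)⁻¹ := by
  let f (k : G) : V →+ V := AddMonoidHom.toMultiplicative.symm
    ((e.toMonoidHom.comp (MulAut.conjNormal k : MulAut P).toMonoidHom).comp e.symm.toMonoidHom)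
  have hf (k : G) (v : V) :
      Multiplicative.ofAdd (f k v) = e (MulAut.conjNormal k (e.symm (.ofAdd v))) := rfl
  refine ⟨{ toFun := fun k ↦ (f k).toZModLinearMap p, map_one' := ?_, map_mul' := ?_ }, ?_⟩
  · ext v
    apply Multiplicative.ofAdd.injective
    simp [hf]
  · intro k l
    ext v
    apply Multiplicative.ofAdd.injective
    simp [hf]
  · intro k v
    simp [hf]

/-- A subgroup meeting `A` trivially and contained in `B` is cyclic when `B / A` is. -/
theorem CyclicQuot.isCyclic_of_injective {G M : Type*} [Group G] [Group M] {A B : Subgroup G}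
    {hA : A.Normal} (h : CyclicQuot A B hA) (f : M →* G) (hB : ∀ x, f x ∈ B)
    (hinj : ∀ x, f x ∈ A → x = 1) : IsCyclic M := by
  let : (A.subgroupOf B).Normal := hA.subgroupOf B
  have : IsCyclic (B ⧸ A.subgroupOf B) := h
  refine _root_.isCyclic_of_injective
    ((QuotientGroup.mk' (A.subgroupOf B)).comp (f.codRestrict B hB)) ?_
  rw [injective_iff_map_eq_one]
  intro x hx
  refine hinj x ?_
  simpa [Subgroup.mem_subgroupOf] using hx

/-- A complement of a Sylow `p`-subgroup has order prime to `p`. -/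
theorem Subgroup.IsComplement'.not_dvd_card_right {G : Type*} [Group G] [Finite G]
    {p : ℕ} (hp : p.Prime) {P K : Subgroup G} (h : P.IsComplement' K)
    (hP : Nat.card P = p ^ (Nat.card G).factorization p) : ¬ p ∣ Nat.card K := by
  intro hdvd
  refine Nat.pow_succ_factorization_not_dvd (n := Nat.card G) Nat.card_pos.ne' hp ?_
  calc p ^ ((Nat.card G).factorization p + 1) = Nat.card P * p := by rw [hP, pow_succ]
    _ ∣ Nat.card P * Nat.card K := mul_dvd_mul_left _ hdvd
    _ = Nat.card G := h.card_mul_card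

/-- Let `G = P ⋊ K` be a finite supersolvable group, where `P` is the normal
Sylow `p`-subgroup for the largest prime `p` dividing `|G|`, `K` is a
complement to `P`, and `P ≅ (ℤ/pℤ)^r` is elementary abelian.  Then the
conjugation action of `K` on `P` diagonalizes: `P` is the (internal) direct sum
of `r` subgroups `Q i`, each of order `p` and each invariant under conjugation
by `K`. -/
theorem conjugation_action_diagonalizes
    {G : Type*} [Group G] [Finite G] (hG : Supersolvable G)
    {p : ℕ} (hp : p.Prime) (hdvd : p ∣ Nat.card G)
    (hmax : ∀ q : ℕ, q.Prime → q ∣ Nat.card G → q ≤ p)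
    (P K : Subgroup G) (hPnormal : P.Normal)
    (hSylow : Nat.card P = p ^ (Nat.card G).factorization p)
    (hcompl : Subgroup.IsComplement' P K)
    (r : ℕ) (iso : P ≃* (Fin r → Multiplicative (ZMod p))) :
    ∃ Q : Fin r → Subgroup G,
      (∀ i, Q i ≤ P) ∧
      (∀ i, Nat.card (Q i) = p) ∧
      (∀ i, ∀ k ∈ K, ∀ x ∈ Q i, k * x * k⁻¹ ∈ Q i) ∧
      iSupIndep Q ∧ (⨆ i, Q i) = P := by
  have := Fact.mk hp
  let V := Fin r → ZMod p
  let e : P ≃* Multiplicative V := iso.trans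
    { toFun := fun x ↦ .ofAdd fun i ↦ (x i).toAdd
      invFun := fun v i ↦ .ofAdd (v.toAdd i)
      left_inv := fun _ ↦ rfl
      right_inv := fun _ ↦ rfl
      map_mul' := fun _ _ ↦ rfl }
  obtain ⟨ρ, hρ⟩ := Representation.exists_conj_apply p K e
  let E : Multiplicative V →* G := P.subtype.comp e.symm.toMonoidHom
  have hE : Function.Injective E := P.subtype_injective.comp e.symm.injective
  have hEP (v : Multiplicative V) : E v ∈ P := (e.symm v).2
  have hEρ (k : K) (v : V) : E (.ofAdd (ρ k v)) = k * E (.ofAdd v) * (k : G)⁻¹ := hρ k v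
  have : NeZero (Nat.card K : ZMod p) :=
    ⟨by rw [Ne, ZMod.natCast_eq_zero_iff]; exact hcompl.not_dvd_card_right hp hSylow⟩
  have : ComplementedLattice (Subrepresentation ρ) :=
    inferInstanceAs (Representation.IsSemisimpleRepresentation ρ)
  obtain ⟨n, H, hnorm, hbot, htop, hmono, hcyc⟩ := hG
  let T : Submodule (ZMod p) V ≃o Subgroup (Multiplicative V) :=
    (AddSubgroup.toZModSubmodule p).symm.trans AddSubgroup.toSubgroup
  have hT (W : Submodule (ZMod p) V) (v : V) : .ofAdd v ∈ T W ↔ v ∈ W := Iff.rfl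
  let A (i : Fin (n + 1)) : Subrepresentation ρ :=
    { toSubmodule := T.symm ((H i).comap E)
      apply_mem_toSubmodule := fun k v hv ↦ by
        change E (.ofAdd (ρ k v)) ∈ H i
        rw [hEρ]
        exact (hnorm i).conj_mem _ hv _ }
  have hA (i : Fin (n + 1)) (v : V) : v ∈ (A i).toSubmodule ↔ E (.ofAdd v) ∈ H i := Iff.rfl
  have hspan : Submodule.span (ZMod p) {v : V | ∀ k, ∃ c : ZMod p, ρ k v = c • v} = ⊤ := by
    refine ρ.span_eigenvectors_eq_top A ?_ ?_ ?_ ?_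
    · apply Subrepresentation.toSubmodule_injective
      refine le_bot_iff.mp fun v hv ↦ ?_
      rw [hA, hbot, Subgroup.mem_bot] at hv
      exact Multiplicative.ofAdd.injective (hE (hv.trans E.map_one.symm))
    · apply Subrepresentation.toSubmodule_injective
      refine top_le_iff.mp fun v _ ↦ ?_
      rw [hA, htop]
      trivial
    · exact fun i v hv ↦ hmono i hv
    · intro i W hW hdisj
      have : IsCyclic (T W) := (hcyc i).isCyclic_of_injective (E.comp (T W).subtype)
        (fun x ↦ hW x.2) fun x hx ↦
          Subtype.ext (Submodule.disjoint_def.mp hdisj x.1.toAdd x.2 hx)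
      obtain ⟨q, hq⟩ := IsCyclic.exists_generator (α := T W)
      refine ⟨q.1.toAdd, le_antisymm (fun x hx ↦ ?_) ?_⟩
      · obtain ⟨m, hm⟩ := Subgroup.mem_zpowers_iff.mp (hq ⟨.ofAdd x, hx⟩)
        have hx : x = m • q.1.toAdd := congrArg (fun y ↦ y.1.toAdd) hm.symm
        rw [hx]
        exact zsmul_mem (Submodule.mem_span_singleton_self _) m
      · rw [Submodule.span_singleton_le_iff_mem]
        exact q.2
  let B := Module.Basis.ofSpan hspan.ge
  let b : Module.Basis (Fin r) (ZMod p) V := B.reindex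
    (B.indexEquiv (Pi.basisFun (ZMod p) (Fin r)))
  have hb (i : Fin r) (k : K) : ∃ c : ZMod p, ρ k (b i) = c • b i := by
    have : b i ∈ Set.range B := by simp [b]
    exact Module.Basis.ofSpan_subset hspan.ge this k
  have hindep := b.linearIndependent.iSupIndep_span_singleton
  refine ⟨fun i ↦ (T (Submodule.span (ZMod p) {b i})).map E, fun i ↦ ?_, fun i ↦ ?_, ?_, ?_, ?_⟩
  · rintro _ ⟨v, -, rfl⟩
    exact hEP v
  · rw [Subgroup.card_map_of_injective hE]
    change Nat.card (Submodule.span (ZMod p) {b i}) = p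
    rw [← Nat.card_congr (LinearEquiv.toSpanNonzeroSingleton (ZMod p) V (b i) (b.ne_zero i)).toEquiv,
      Nat.card_zmod]
  · rintro i k hk _ ⟨v, hv, rfl⟩
    refine ⟨.ofAdd (ρ ⟨k, hk⟩ v.toAdd), ?_, hEρ ⟨k, hk⟩ v.toAdd⟩
    obtain ⟨c, hc⟩ := Submodule.mem_span_singleton.mp ((hT _ v.toAdd).mp hv)
    obtain ⟨d, hd⟩ := hb i ⟨k, hk⟩
    refine (hT _ _).mpr ?_
    rw [← hc, map_smul, hd]
    exact Submodule.smul_mem _ _ (Submodule.smul_mem _ _ (Submodule.mem_span_singleton_self _))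
  · intro i
    simp only [← Subgroup.map_iSup]
    exact Subgroup.disjoint_map hE (hindep.map_orderIso T i)
  · rw [← Subgroup.map_iSup, ← T.map_iSup, ← Submodule.span_range_eq_iSup, b.span_eq, T.map_top,
      ← MonoidHom.range_eq_map]
    refine le_antisymm ?_ fun x hx ↦ ⟨e ⟨x, hx⟩, by simp [E]⟩
    rintro _ ⟨v, rfl⟩
    exact hEP v
end

section
/- Let G = P ⋊ K be a finite supersolvable group with Φ(G) ∩ [G,G] = 1, where P is the normal Sylow p-subgroup of G for the largest prime p dividing |G| and K is a complement to P. Then the commutator subgroup [K,K] centralizes P; that is, every element of [K,K] commutes with every element of P. -/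
/-- The commutator subgroup acts trivially on a cyclic normal subgroup. -/
theorem commutator_le_centralizer_of_isCyclic {G : Type*} [Group G]
    (N : Subgroup G) [N.Normal] [IsCyclic N] :
    commutator G ≤ Subgroup.centralizer (N : Set G) := by
  let _ : CommGroup (MulAut N) :=
    { mul_comm := fun a b => (IsCyclic.mulAutMulEquiv N).injective (by
        rw [map_mul, map_mul, mul_comm]) }
  intro g hg
  have hker : MulAut.conjNormal g = (1 : MulAut N) :=
    Abelianization.commutator_subset_ker (MulAut.conjNormal (H := N)) hg
  rw [Subgroup.mem_centralizer_iff]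
  intro x hx
  have h := congrArg Subtype.val (DFunLike.congr_fun hker ⟨x, hx⟩)
  rw [MulAut.conjNormal_apply, MulAut.one_apply] at h
  exact (mul_inv_eq_iff_eq_mul.mp h).symm

open scoped commutatorElement in
/-- The commutator subgroup acts trivially on a cyclic normal section. -/
theorem CyclicQuot.commutatorElement_mem {G : Type*} [Group G]
    {A B : Subgroup G} {hA : A.Normal} (hB : B.Normal) (h : CyclicQuot A B hA)
    {g x : G} (hg : g ∈ commutator G) (hx : x ∈ B) : ⁅g, x⁆ ∈ A := by
  have : (A.subgroupOf B).Normal := hA.subgroupOf B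
  have : IsCyclic (B ⧸ A.subgroupOf B) := h
  let N := B.map (QuotientGroup.mk' A)
  have : N.Normal := hB.map _ (QuotientGroup.mk'_surjective A)
  have hle : A.subgroupOf B ≤ ((QuotientGroup.mk' A).subgroupMap B).ker := by
    intro b hb
    exact Subtype.ext ((QuotientGroup.eq_one_iff (b : G)).mpr hb)
  have : IsCyclic N := isCyclic_of_surjective (QuotientGroup.lift _ _ hle)
    (QuotientGroup.lift_surjective_of_surjective _ _
      ((QuotientGroup.mk' A).subgroupMap_surjective B) hle)
  have hg' : QuotientGroup.mk' A g ∈ commutator (G ⧸ A) := by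
    have := Subgroup.mem_map_of_mem (QuotientGroup.mk' A) hg
    rw [commutator_def, Subgroup.map_commutator] at this
    exact Subgroup.commutator_mono le_top le_top this
  have hcomm := Subgroup.mem_centralizer_iff.mp (commutator_le_centralizer_of_isCyclic N hg')
    _ (Subgroup.mem_map_of_mem (QuotientGroup.mk' A) hx)
  rw [← QuotientGroup.ker_mk' A, MonoidHom.mem_ker, map_commutatorElement,
    commutatorElement_eq_one_iff_mul_comm]
  exact hcomm.symm

open scoped commutatorElement in
/-- If `⁅g, x⁆` commutes with `g` and has order coprime to that of `g`, then `g` commutes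
with `x`. -/
theorem Commute.of_commutatorElement {G : Type*} [Group G] {g x : G}
    (h : Commute g ⁅g, x⁆) (hcop : (orderOf g).Coprime (orderOf ⁅g, x⁆)) : Commute g x := by
  have hconj (n : ℕ) : g ^ n * x * (g ^ n)⁻¹ = ⁅g, x⁆ ^ n * x := by
    induction n with
    | zero => simp
    | succ n ih =>
      calc g ^ (n + 1) * x * (g ^ (n + 1))⁻¹
          = g * (g ^ n * x * (g ^ n)⁻¹) * g⁻¹ := by rw [pow_succ']; group
        _ = g * ⁅g, x⁆ ^ n * x * g⁻¹ := by rw [ih]; group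
        _ = ⁅g, x⁆ ^ (n + 1) * x := by
          rw [(h.pow_right n).eq, pow_succ, commutatorElement_def]; group
  have hpow : ⁅g, x⁆ ^ orderOf g = 1 := by
    have := hconj (orderOf g)
    rw [pow_orderOf_eq_one] at this
    simpa using this
  rw [← commutatorElement_eq_one_iff_commute, ← orderOf_eq_one_iff]
  exact hcop.symm.eq_one_of_dvd (orderOf_dvd_of_pow_eq_one hpow)

/-- Let `G = P ⋊ K` be a finite supersolvable group with
`Φ(G) ∩ [G,G] = 1`, where `P` is the normal Sylow `p`-subgroup for the largest
prime `p` dividing `|G|` and `K` is a complement to `P`.  Then `[K,K]`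
centralizes `P`. -/
theorem commutator_centralizes
    {G : Type*} [Group G] [Finite G] (hG : Supersolvable G)
    (hfrattini : frattini G ⊓ commutator G = ⊥)
    {p : ℕ} (hp : p.Prime) (hdvd : p ∣ Nat.card G)
    (hmax : ∀ q : ℕ, q.Prime → q ∣ Nat.card G → q ≤ p)
    (P K : Subgroup G) (hPnormal : P.Normal)
    (hSylow : Nat.card P = p ^ (Nat.card G).factorization p)
    (hcompl : Subgroup.IsComplement' P K) :
    ∀ g ∈ ⁅K, K⁆, ∀ x ∈ P, g * x = x * g := by
  obtain ⟨n, H, hnorm, h0, hlast, -, hcyc⟩ := hG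
  have hPK : (Nat.card K).Coprime (Nat.card P) := by
    have hcard := hcompl.card_mul_card
    have hK : Nat.card K = ordCompl[p] (Nat.card G) := by
      rw [← hSylow]
      exact (Nat.div_eq_of_eq_mul_right Nat.card_pos hcard.symm).symm
    rw [hK, hSylow]
    exact (Nat.coprime_ordCompl hp Nat.card_pos.ne').symm.pow_right _
  intro g hg
  have hgK : g ∈ K := Subgroup.commutator_le_self K hg
  have hgG : g ∈ commutator G := Subgroup.commutator_mono le_top le_top hg
  have hcent (i : Fin (n + 1)) : ∀ x ∈ P, x ∈ H i → Commute g x := by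
    induction i using Fin.induction with
    | zero =>
      intro x _ hx
      rw [h0, Subgroup.mem_bot] at hx
      exact hx ▸ Commute.one_right g
    | succ i ih =>
      intro x hxP hx
      open scoped commutatorElement in
      have hcP : ⁅g, x⁆ ∈ P :=
        P.mul_mem (hPnormal.conj_mem x hxP g) (P.inv_mem hxP)
      exact Commute.of_commutatorElement
        (ih _ hcP ((hcyc i).commutatorElement_mem (hnorm _) hgG hx))
        ((hPK.coprime_dvd_left (K.orderOf_dvd_natCard hgK)).coprime_dvd_right
          (P.orderOf_dvd_natCard hcP))
  exact fun x hx => hcent (Fin.last n) x hx (hlast ▸ Subgroup.mem_top x)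
end
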